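/- Let i be an interior vertex of a triangulation with 1-ring neighborhood R_i, and let φ, φ': R_i → ℂ be two Delaunay geodesic embeddings with induced PL metrics l, l' that are discrete conformal, l' = u * l. Then max over all vertices j of R_i of |u_j| is attained on the boundary vertices of R_i: max_{j ∈ R_i} |u_j| ≤ max_{j ∈ ∂R_i} |u_j|. Moreover, if |u_i| = max_{j ∈ R_i} |u_j| then u is constant on R_i. -/

import Mathlib

open Real EuclideanGeometry

/-- A geodesic embedding of the 1-ring neighborhood (star) of an interior vertex
into `ℂ`: the center vertex is sent to `p` and the `m` boundary neighbors to
`q 0, …, q (m-1)` in cyclic order; each triangle `p (q k) (q (k+1))` is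
nondegenerate and positively oriented, and the triangles wind once around `p`. -/
def IsStarEmbedding {m : ℕ} [NeZero m] (p : ℂ) (q : Fin m → ℂ) : Prop :=
  (∀ k : Fin m, AffineIndependent ℝ ![p, q k, q (k + 1)]) ∧
  (∀ k : Fin m, Complex.arg ((q (k + 1) - p) / (q k - p)) ∈ Set.Ioo 0 π) ∧
  (∑ k : Fin m, Complex.arg ((q (k + 1) - p) / (q k - p)) = 2 * π)

/-- The Delaunay condition for a star: for every pair of adjacent triangles the
fourth vertex is not inside the circumscribed circle of the other triangle. -/
def IsDelaunayStar {m : ℕ} [NeZero m] (p : ℂ) (q : Fin m → ℂ) : Prop :=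
  ∀ (k : Fin m) (c : ℂ) (r : ℝ),
    dist p c = r → dist (q k) c = r → dist (q (k + 1)) c = r →
    r ≤ dist (q (k + 2)) c ∧ r ≤ dist (q (k - 1)) c

theorem hd_aux (a b da db l t : ℝ) (ha : 0 < a + t * da) (hb : 0 < b + t * db)
    (hT : 0 < 4 * (a + t * da) * (b + t * db) - (a + t * da + (b + t * db) - l ^ 2) ^ 2) :
    HasDerivAt (fun t : ℝ => Real.arccos ((a + t * da + (b + t * db) - l ^ 2) /
        (2 * √((a + t * da) * (b + t * db)))))
      (-(da / (2 * (a + t * da)) * ((a + t * da + l ^ 2 - (b + t * db)) /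
            √(4 * (a + t * da) * (b + t * db) - (a + t * da + (b + t * db) - l ^ 2) ^ 2))
        + db / (2 * (b + t * db)) * ((b + t * db + l ^ 2 - (a + t * da)) /
            √(4 * (a + t * da) * (b + t * db) - (a + t * da + (b + t * db) - l ^ 2) ^ 2)))) t := by
  have h1 : HasDerivAt (fun t : ℝ => a + t * da) da t := by
    simpa using ((hasDerivAt_id t).mul_const da).const_add a
  have h2 : HasDerivAt (fun t : ℝ => b + t * db) db t := by
    simpa using ((hasDerivAt_id t).mul_const db).const_add b
  have hab := mul_pos ha hb
  have hs := ((h1.mul h2).sqrt (by exact hab.ne')).const_mul 2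
  have hR : 0 < √((a + t * da) * (b + t * db)) := Real.sqrt_pos.2 hab
  have hC := ((h1.add h2).sub_const (l ^ 2)).div hs (by simpa using hR.ne')
  have hR2 : √((a + t * da) * (b + t * db)) ^ 2 = (a + t * da) * (b + t * db) := Real.sq_sqrt hab.le
  have hS2 := Real.sq_sqrt hT.le
  have hS := Real.sqrt_pos.2 hT
  simp only [Pi.mul_apply, Pi.add_apply] at hC
  set S := √(4 * (a + t * da) * (b + t * db) - (a + t * da + (b + t * db) - l ^ 2) ^ 2) with hSd
  have hCsq : 1 - ((a + t * da + (b + t * db) - l ^ 2) / (2 * √((a + t * da) * (b + t * db)))) ^ 2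
      = (S / (2 * √((a + t * da) * (b + t * db)))) ^ 2 := by
    rw [div_pow, div_pow, mul_pow, hR2, hS2]
    field_simp
    ring
  have hpos : 0 < (S / (2 * √((a + t * da) * (b + t * db)))) ^ 2 := by positivity
  have hne1 : (a + t * da + (b + t * db) - l ^ 2) / (2 * √((a + t * da) * (b + t * db))) ≠ -1 := by
    intro h; rw [h] at hCsq; norm_num at hCsq; rw [← hCsq] at hpos; exact lt_irrefl _ hpos
  have hne2 : (a + t * da + (b + t * db) - l ^ 2) / (2 * √((a + t * da) * (b + t * db))) ≠ 1 := by
    intro h; rw [h] at hCsq; norm_num at hCsq; rw [← hCsq] at hpos; exact lt_irrefl _ hpos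
  have := (Real.hasDerivAt_arccos hne1 hne2).comp t hC
  refine this.congr_deriv ?_
  rw [hCsq, Real.sqrt_sq (by positivity)]
  clear_value S
  generalize hRR : √((a + t * da) * (b + t * db)) = R at *
  generalize a + t * da = A at *
  generalize b + t * db = B at *
  have hA := ha.ne'
  have hB := hb.ne'
  have hS' := hS.ne'
  have hR' := hR.ne'
  field_simp
  have e : A = R ^ 2 / B := by rw [hR2]; field_simp
  rw [hR2]
  ring

theorem L1_aux (X Y h k : ℝ) (hh : 0 < h) (hk : 0 < k) (he : X ^ 2 + h ^ 2 = Y ^ 2 + k ^ 2)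
    (hs : 0 ≤ X + Y) : 0 ≤ X / h + Y / k ∧ (X / h + Y / k = 0 → X + Y = 0) := by
  have key : X / h + Y / k = (X * k + Y * h) / (h * k) := by field_simp
  rw [key]
  have main : min h k * (X + Y) ≤ X * k + Y * h := by
    rcases le_total h k with hle | hle
    · rw [min_eq_left hle]
      have : Y ^ 2 ≤ X ^ 2 := by nlinarith
      have hX : 0 ≤ X * (k - h) := by
        rcases le_or_gt 0 X with hX | hX
        · exact mul_nonneg hX (by linarith)
        · have : X ^ 2 ≤ Y ^ 2 := by nlinarith
          have : k = h := by nlinarith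
          rw [this]; simp
      nlinarith
    · rw [min_eq_right hle]
      have : X ^ 2 ≤ Y ^ 2 := by nlinarith
      have hX : 0 ≤ Y * (h - k) := by
        rcases le_or_gt 0 Y with hX | hX
        · exact mul_nonneg hX (by linarith)
        · have : Y ^ 2 ≤ X ^ 2 := by nlinarith
          have : k = h := by nlinarith
          rw [this]; simp
      nlinarith
  have hm : 0 < min h k := lt_min hh hk
  constructor
  · exact div_nonneg (le_trans (by positivity) main) (by positivity)
  · intro h0
    rw [div_eq_zero_iff] at h0
    rcases h0 with h0 | h0
    · rw [h0] at main
      nlinarith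
    · exact absurd h0 (by positivity)

/-- bracket at a vertex with squared radius `y`, neighbours `a`, `b`, edges `l`, `n`. -/
theorem L2_aux (y a b l n : ℝ) (hl : 0 < l) (hn : 0 < n)
    (hTa : 0 < 4 * a * y - (a + y - l ^ 2) ^ 2) (hTb : 0 < 4 * y * b - (y + b - n ^ 2) ^ 2)
    (hs : 0 ≤ (y + l ^ 2 - a) / l + (y + n ^ 2 - b) / n) :
    0 ≤ (y + l ^ 2 - a) / √(4 * a * y - (a + y - l ^ 2) ^ 2)
      + (y + n ^ 2 - b) / √(4 * y * b - (y + b - n ^ 2) ^ 2) ∧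
    ((y + l ^ 2 - a) / √(4 * a * y - (a + y - l ^ 2) ^ 2)
      + (y + n ^ 2 - b) / √(4 * y * b - (y + b - n ^ 2) ^ 2) = 0 →
      (y + l ^ 2 - a) / l + (y + n ^ 2 - b) / n = 0) := by
  have h1 := Real.sq_sqrt hTa.le
  have h2 := Real.sq_sqrt hTb.le
  have p1 := Real.sqrt_pos.2 hTa
  have p2 := Real.sqrt_pos.2 hTb
  have := L1_aux ((y + l ^ 2 - a) / l) ((y + n ^ 2 - b) / n)
    (√(4 * a * y - (a + y - l ^ 2) ^ 2) / l) (√(4 * y * b - (y + b - n ^ 2) ^ 2) / n)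
    (by positivity) (by positivity) (by
      rw [div_pow, div_pow, div_pow, div_pow, h1, h2]; field_simp; ring) hs
  rwa [div_div_div_cancel_right₀ hl.ne', div_div_div_cancel_right₀ hn.ne'] at this

theorem fin_all {m : ℕ} [NeZero m] (P : Fin m → Prop) (k0 : Fin m) (h0 : P k0)
    (hs : ∀ k, P k → P (k + 1)) : ∀ k, P k := by
  have h : ∀ n : ℕ, P (k0 + n • (1 : Fin m)) := by
    intro n
    induction n with
    | zero => simpa using h0
    | succ n ih => rw [succ_nsmul, ← add_assoc]; exact hs _ ih
  intro k
  have := h (k - k0).val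
  have hv : ∀ n : ℕ, (n • (1 : Fin m)).val = n % m := by
    intro n
    induction n with
    | zero => simp
    | succ n ih => rw [succ_nsmul, Fin.val_add, ih, Fin.val_one', Nat.add_mod n 1 m]
  have e : (k - k0).val • (1 : Fin m) = k - k0 := by
    apply Fin.ext
    rw [hv, Nat.mod_eq_of_lt (k - k0).isLt]
  rw [e] at this
  simpa using this

theorem core {m : ℕ} [NeZero m] (y z l : Fin m → ℝ) (hl : ∀ k, 0 < l k) (hy : ∀ k, 0 < y k)
    (hyz : ∀ k, y k ≤ z k)
    (hTy : ∀ k, 0 < 4 * y k * y (k + 1) - (y k + y (k + 1) - l k ^ 2) ^ 2)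
    (hTz : ∀ k, 0 < 4 * z k * z (k + 1) - (z k + z (k + 1) - l k ^ 2) ^ 2)
    (hDy : ∀ k, 0 ≤ (y (k + 1) + l k ^ 2 - y k) / l k
        + (y (k + 1) + l (k + 1) ^ 2 - y (k + 1 + 1)) / l (k + 1))
    (hDz : ∀ k, 0 ≤ (z (k + 1) + l k ^ 2 - z k) / l k
        + (z (k + 1) + l (k + 1) ^ 2 - z (k + 1 + 1)) / l (k + 1))
    (hsum : ∑ k, Real.arccos ((y k + y (k + 1) - l k ^ 2) / (2 * √(y k * y (k + 1)))) =
      ∑ k, Real.arccos ((z k + z (k + 1) - l k ^ 2) / (2 * √(z k * z (k + 1))))) :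
    ∀ k, z k = y k := by
  set δ : Fin m → ℝ := fun k => z k - y k with hδ
  have hδ0 : ∀ k, 0 ≤ δ k := fun k => sub_nonneg.2 (hyz k)
  set Y : ℝ → Fin m → ℝ := fun t k => y k + t * δ k with hY
  have hYpos : ∀ t, 0 ≤ t → ∀ k, 0 < Y t k := fun t ht k => by
    have := hy k; have := hδ0 k; simp only [hY]; positivity
  have hT : ∀ t, 0 ≤ t → t ≤ 1 → ∀ k,
      0 < 4 * Y t k * Y t (k + 1) - (Y t k + Y t (k + 1) - l k ^ 2) ^ 2 := by
    intro t h0 h1 k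
    have e : 4 * Y t k * Y t (k + 1) - (Y t k + Y t (k + 1) - l k ^ 2) ^ 2
      = (1 - t) * (4 * y k * y (k + 1) - (y k + y (k + 1) - l k ^ 2) ^ 2)
        + t * (4 * z k * z (k + 1) - (z k + z (k + 1) - l k ^ 2) ^ 2)
        + t * (1 - t) * (δ k - δ (k + 1)) ^ 2 := by
      simp only [hY, hδ]; ring
    rw [e]
    have a1 := hTy k
    have a2 := hTz k
    have a3 : 0 ≤ t * (1 - t) * (δ k - δ (k + 1)) ^ 2 :=
      mul_nonneg (mul_nonneg h0 (by linarith)) (sq_nonneg _)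
    have a4 : 0 < (1 - t) * (4 * y k * y (k + 1) - (y k + y (k + 1) - l k ^ 2) ^ 2)
        + t * (4 * z k * z (k + 1) - (z k + z (k + 1) - l k ^ 2) ^ 2) := by
      rcases h0.eq_or_lt with h | h
      · subst h; simpa using a1
      · have := mul_pos h a2
        have := mul_nonneg (sub_nonneg.2 h1) a1.le
        linarith
    linarith
  set D : (Fin m → ℝ) → Fin m → ℝ := fun y k => (y (k + 1) + l k ^ 2 - y k) / l k
        + (y (k + 1) + l (k + 1) ^ 2 - y (k + 1 + 1)) / l (k + 1) with hDdef
  have hDlin : ∀ t k, D (Y t) k = (1 - t) * D y k + t * D z k := by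
    intro t k; simp only [hDdef, hY, hδ]; ring
  have hDY : ∀ t, 0 ≤ t → t ≤ 1 → ∀ k, 0 ≤ D (Y t) k := by
    intro t h0 h1 k
    rw [hDlin]
    exact add_nonneg (mul_nonneg (by linarith) (hDy k)) (mul_nonneg h0 (hDz k))
  set f : ℝ → ℝ := fun t => ∑ k, Real.arccos ((Y t k + Y t (k + 1) - l k ^ 2) /
    (2 * √(Y t k * Y t (k + 1)))) with hf
  set S : ℝ → Fin m → ℝ := fun t k =>
    √(4 * Y t k * Y t (k + 1) - (Y t k + Y t (k + 1) - l k ^ 2) ^ 2) with hS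
  set G : ℝ → Fin m → ℝ := fun t k => (Y t (k + 1) + l k ^ 2 - Y t k) / S t k
      + (Y t (k + 1) + l (k + 1) ^ 2 - Y t (k + 1 + 1)) / S t (k + 1) with hG
  have hGp : ∀ t, 0 ≤ t → t ≤ 1 → ∀ k, 0 ≤ G t k ∧ (G t k = 0 → D (Y t) k = 0) :=
    fun t h0 h1 k => L2_aux _ _ _ _ _ (hl _) (hl _) (hT t h0 h1 k) (hT t h0 h1 (k + 1))
      (hDY t h0 h1 k)
  have hfd : ∀ t, 0 ≤ t → t ≤ 1 →
      HasDerivAt f (-∑ k, δ (k + 1) / (2 * Y t (k + 1)) * G t k) t := by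
    intro t h0 h1
    have := HasDerivAt.fun_sum (u := Finset.univ) (fun k _ => hd_aux (y k) (y (k + 1)) (δ k) (δ (k + 1)) (l k) t
      (hYpos t h0 k) (hYpos t h0 (k + 1)) (hT t h0 h1 k))
    refine this.congr_deriv ?_
    rw [Finset.sum_neg_distrib, Finset.sum_add_distrib]
    congr 1
    rw [← Equiv.sum_comp (Equiv.addRight (1 : Fin m)), ← Finset.sum_add_distrib]
    refine Finset.sum_congr rfl fun k _ => ?_
    simp only [hG, hS, hY, Equiv.coe_addRight]
    ring
  have hterm : ∀ t, 0 ≤ t → t ≤ 1 → ∀ k, 0 ≤ δ (k + 1) / (2 * Y t (k + 1)) * G t k := by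
    intro t h0 h1 k
    have := hYpos t h0 (k + 1)
    have := hδ0 (k + 1)
    have := (hGp t h0 h1 k).1
    positivity
  have hanti : AntitoneOn f (Set.Icc 0 1) := by
    apply antitoneOn_of_deriv_nonpos (convex_Icc 0 1)
    · intro t ht
      exact (hfd t ht.1 ht.2).continuousAt.continuousWithinAt
    · intro t ht
      rw [interior_Icc] at ht
      exact (hfd t ht.1.le ht.2.le).differentiableAt.differentiableWithinAt
    · intro t ht
      rw [interior_Icc] at ht
      rw [(hfd t ht.1.le ht.2.le).deriv]
      exact neg_nonpos.2 (Finset.sum_nonneg fun k _ => hterm t ht.1.le ht.2.le k)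
  have hf01 : f 0 = f 1 := by
    simpa [hf, hY, hδ] using hsum
  have hconst : ∀ t ∈ Set.Icc (0 : ℝ) 1, f t = f 0 := by
    intro t ht
    apply le_antisymm
    · exact hanti (by simp) ht ht.1
    · rw [hf01]; exact hanti ht (by simp) ht.2
  have hd0 : -∑ k, δ (k + 1) / (2 * Y (1 / 2) (k + 1)) * G (1 / 2) k = 0 := by
    have h1 := hfd (1 / 2) (by norm_num) (by norm_num)
    have h2 : HasDerivAt f 0 (1 / 2) := by
      refine (hasDerivAt_const (1 / 2 : ℝ) (f 0)).congr_of_eventuallyEq ?_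
      filter_upwards [Icc_mem_nhds (show (0 : ℝ) < 1 / 2 by norm_num)
        (show (1 / 2 : ℝ) < 1 by norm_num)] with t ht using hconst t ht
    exact h1.unique h2
  rw [neg_eq_zero, Finset.sum_eq_zero_iff_of_nonneg
    (fun k _ => hterm _ (by norm_num) (by norm_num) k)] at hd0
  have hflat : ∀ k, 0 < δ (k + 1) → D y k = 0 ∧ D z k = 0 := by
    intro k hk
    have h0 := hd0 k (Finset.mem_univ _)
    have hp := hYpos (1 / 2) (by norm_num) (k + 1)
    have hne : δ (k + 1) / (2 * Y (1 / 2) (k + 1)) ≠ 0 := by positivity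
    have hG0 := (mul_eq_zero.1 h0).resolve_left hne
    have hD0 := (hGp (1 / 2) (by norm_num) (by norm_num) k).2 hG0
    rw [hDlin] at hD0
    have a := hDy k
    have b := hDz k
    change 0 ≤ D y k at a
    change 0 ≤ D z k at b
    constructor <;> linarith
  obtain ⟨k0, hk0⟩ := Finite.exists_max δ
  by_cases hpos : 0 < δ k0
  · exfalso
    have hall : ∀ k, δ k = δ k0 := by
      apply fin_all (fun k => δ k = δ k0) k0 rfl
      intro k hk
      obtain ⟨j, rfl⟩ : ∃ j, k = j + 1 := ⟨k - 1, by simp⟩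
      obtain ⟨e1, e2⟩ := hflat j (by rw [hk]; exact hpos)
      have e3 : (δ (j + 1) - δ j) / l j + (δ (j + 1) - δ (j + 1 + 1)) / l (j + 1) = 0 := by
        have : D z j - D y j = 0 := by rw [e1, e2]; ring
        rw [← this]; simp only [hDdef, hδ]; ring
      have i1 : 0 ≤ (δ (j + 1) - δ j) / l j :=
        div_nonneg (by rw [hk]; linarith [hk0 j]) (hl _).le
      have i2 : 0 ≤ (δ (j + 1) - δ (j + 1 + 1)) / l (j + 1) :=
        div_nonneg (by rw [hk]; linarith [hk0 (j + 1 + 1)]) (hl _).le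
      have i3 : (δ (j + 1) - δ (j + 1 + 1)) / l (j + 1) = 0 := by linarith
      rw [div_eq_zero_iff] at i3
      rcases i3 with i3 | i3
      · linarith
      · exact absurd i3 (hl _).ne'
    have hz : ∑ k, D y k = 0 :=
      Finset.sum_eq_zero fun k _ => (hflat k (by rw [hall]; exact hpos)).1
    have hz2 : ∑ k, D y k = ∑ k, 2 * l k := by
      simp only [hDdef]
      rw [Finset.sum_add_distrib]
      have := Equiv.sum_comp (Equiv.addRight (1 : Fin m))
        (fun k => (y k + l k ^ 2 - y (k + 1)) / l k)
      simp only [Equiv.coe_addRight] at this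
      rw [this, ← Finset.sum_add_distrib]
      refine Finset.sum_congr rfl fun k _ => ?_
      have := (hl k).ne'
      field_simp
      ring
    have : 0 < ∑ k, 2 * l k :=
      Finset.sum_pos (fun k _ => by have := hl k; positivity) ⟨k0, Finset.mem_univ _⟩
    rw [← hz2, hz] at this
    exact lt_irrefl _ this
  · intro k
    have h1 := hk0 k
    have h2 := hδ0 k
    have h3 : δ k = z k - y k := rfl
    linarith

theorem circ_aux (p a b d : ℂ)
    (hdet : 0 < (a.re - p.re) * (b.im - p.im) - (a.im - p.im) * (b.re - p.re))
    (H : ∀ (c : ℂ) (r : ℝ), dist p c = r → dist a c = r → dist b c = r → r ≤ dist d c) :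
    0 ≤ ((a.re - p.re) * (b.im - p.im) - (a.im - p.im) * (b.re - p.re)) *
        ((d.re - p.re) ^ 2 + (d.im - p.im) ^ 2)
      - ((a.re - p.re) * (d.im - p.im) - (a.im - p.im) * (d.re - p.re)) *
        ((b.re - p.re) ^ 2 + (b.im - p.im) ^ 2)
      + ((b.re - p.re) * (d.im - p.im) - (b.im - p.im) * (d.re - p.re)) *
        ((a.re - p.re) ^ 2 + (a.im - p.im) ^ 2) := by
  set ax := a.re - p.re with hax
  set ay := a.im - p.im with hay
  set bx := b.re - p.re with hbx
  set bY := b.im - p.im with hby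
  set dx := d.re - p.re with hdx
  set dy := d.im - p.im with hdy
  set Δ := ax * bY - ay * bx with hΔ
  set cx := ((ax ^ 2 + ay ^ 2) * bY - (bx ^ 2 + bY ^ 2) * ay) / (2 * Δ) with hcx
  set cy := (ax * (bx ^ 2 + bY ^ 2) - bx * (ax ^ 2 + ay ^ 2)) / (2 * Δ) with hcy
  have hΔ0 := hdet.ne'
  have ecx : 2 * Δ * cx = (ax ^ 2 + ay ^ 2) * bY - (bx ^ 2 + bY ^ 2) * ay := by
    rw [hcx]; field_simp
  have ecy : 2 * Δ * cy = ax * (bx ^ 2 + bY ^ 2) - bx * (ax ^ 2 + ay ^ 2) := by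
    rw [hcy]; field_simp
  have ea : 2 * (ax * cx + ay * cy) = ax ^ 2 + ay ^ 2 := by
    apply mul_left_cancel₀ hΔ0
    linear_combination ax * ecx + ay * ecy - (ax ^ 2 + ay ^ 2) * hΔ
  have eb : 2 * (bx * cx + bY * cy) = bx ^ 2 + bY ^ 2 := by
    apply mul_left_cancel₀ hΔ0
    linear_combination bx * ecx + bY * ecy - (bx ^ 2 + bY ^ 2) * hΔ
  clear_value cx cy
  have key := H ⟨p.re + cx, p.im + cy⟩ _ rfl
    (by
      rw [Complex.dist_eq_re_im, Complex.dist_eq_re_im]; congr 1; simp only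
      have f1 : a.re = p.re + ax := by rw [hax]; ring
      have f2 : a.im = p.im + ay := by rw [hay]; ring
      rw [f1, f2]; linear_combination -ea)
    (by
      rw [Complex.dist_eq_re_im, Complex.dist_eq_re_im]; congr 1; simp only
      have f1 : b.re = p.re + bx := by rw [hbx]; ring
      have f2 : b.im = p.im + bY := by rw [hby]; ring
      rw [f1, f2]; linear_combination -eb)
  rw [Complex.dist_eq_re_im, Complex.dist_eq_re_im, Real.sqrt_le_sqrt_iff (by positivity)] at key
  simp only at key
  have hd : 2 * (dx * cx + dy * cy) ≤ dx ^ 2 + dy ^ 2 := by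
    rw [hdx, hdy]; linarith
  have := mul_le_mul_of_nonneg_left hd hdet.le
  have e : Δ * (2 * (dx * cx + dy * cy)) = dx * ((ax ^ 2 + ay ^ 2) * bY - (bx ^ 2 + bY ^ 2) * ay)
     + dy * (ax * (bx ^ 2 + bY ^ 2) - bx * (ax ^ 2 + ay ^ 2)) := by
    linear_combination dx * ecx + dy * ecy
  rw [e] at this
  linarith

theorem L1_conv (X Y h k : ℝ) (hh : 0 < h) (hk : 0 < k) (he : X ^ 2 + h ^ 2 = Y ^ 2 + k ^ 2)
    (hs : 0 ≤ X / h + Y / k) : 0 ≤ X + Y := by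
  by_contra hc
  push Not at hc
  obtain ⟨h1, h2⟩ := L1_aux (-X) (-Y) h k hh hk (by simpa using he) (by linarith)
  have e : -X / h + -Y / k = -(X / h + Y / k) := by ring
  rw [e] at h1 h2
  have := h2 (by linarith)
  linarith

theorem norm_sq_re_im (a : ℂ) : ‖a‖ ^ 2 = a.re ^ 2 + a.im ^ 2 := by
  rw [← Complex.normSq_eq_norm_sq, Complex.normSq_apply]; ring

theorem tri_aux (a b : ℂ) (c : ℝ) (hc : 0 < c) (h : Complex.arg (b / a) ∈ Set.Ioo 0 π) :
    a ≠ 0 ∧ b ≠ 0 ∧ 0 < a.re * b.im - a.im * b.re ∧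
    0 < 4 * (c ^ 2 / ‖a‖ ^ 2) * (c ^ 2 / ‖b‖ ^ 2) -
      (c ^ 2 / ‖a‖ ^ 2 + c ^ 2 / ‖b‖ ^ 2 - (c * ‖a - b‖ / (‖a‖ * ‖b‖)) ^ 2) ^ 2 ∧
    Complex.arg (b / a) = Real.arccos
      ((c ^ 2 / ‖a‖ ^ 2 + c ^ 2 / ‖b‖ ^ 2 - (c * ‖a - b‖ / (‖a‖ * ‖b‖)) ^ 2) /
        (2 * √(c ^ 2 / ‖a‖ ^ 2 * (c ^ 2 / ‖b‖ ^ 2)))) := by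
  have ha : a ≠ 0 := by
    rintro rfl; simp at h
  have hb : b ≠ 0 := by
    rintro rfl; simp at h
  have na : 0 < ‖a‖ := norm_pos_iff.2 ha
  have nb : 0 < ‖b‖ := norm_pos_iff.2 hb
  have hw : b / a ≠ 0 := div_ne_zero hb ha
  have nw : 0 < ‖b / a‖ := norm_pos_iff.2 hw
  have sa := norm_sq_re_im a
  have sb := norm_sq_re_im b
  have sab := norm_sq_re_im (a - b)
  simp only [Complex.sub_re, Complex.sub_im] at sab
  have him : 0 < (b / a).im := by
    have h1 := Real.sin_pos_of_pos_of_lt_pi h.1 h.2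
    rw [Complex.sin_arg] at h1
    exact (div_pos_iff_of_pos_right nw).1 h1
  have hdet : 0 < a.re * b.im - a.im * b.re := by
    have e : a.re * b.im - a.im * b.re = (b / a).im * ‖a‖ ^ 2 := by
      rw [Complex.div_im, Complex.normSq_eq_norm_sq]; field_simp
    rw [e]; positivity
  have e1 : c ^ 2 / ‖a‖ ^ 2 + c ^ 2 / ‖b‖ ^ 2 - (c * ‖a - b‖ / (‖a‖ * ‖b‖)) ^ 2
      = 2 * c ^ 2 * (a.re * b.re + a.im * b.im) / (‖a‖ ^ 2 * ‖b‖ ^ 2) := by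
    rw [div_pow, mul_pow, mul_pow, sab]
    field_simp
    rw [sa, sb]; ring
  refine ⟨ha, hb, hdet, ?_, ?_⟩
  · rw [e1]
    have e2 : 4 * (c ^ 2 / ‖a‖ ^ 2) * (c ^ 2 / ‖b‖ ^ 2) -
        (2 * c ^ 2 * (a.re * b.re + a.im * b.im) / (‖a‖ ^ 2 * ‖b‖ ^ 2)) ^ 2
        = 4 * c ^ 4 * (a.re * b.im - a.im * b.re) ^ 2 / (‖a‖ ^ 2 * ‖b‖ ^ 2) ^ 2 := by
      field_simp
      rw [sa, sb]; ring
    rw [e2]; positivity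
  · rw [e1]
    have e3 : √(c ^ 2 / ‖a‖ ^ 2 * (c ^ 2 / ‖b‖ ^ 2)) = c ^ 2 / (‖a‖ * ‖b‖) := by
      rw [← Real.sqrt_sq (show 0 ≤ c ^ 2 / (‖a‖ * ‖b‖) by positivity)]
      congr 1; field_simp
    rw [e3, ← Real.arccos_cos h.1.le h.2.le, Complex.cos_arg hw]
    congr 1
    rw [Complex.div_re, Complex.normSq_eq_norm_sq, norm_div]
    field_simp

theorem del_aux (a b d : ℂ) (c : ℝ) (hc : 0 < c) (ha : a ≠ 0) (hb : b ≠ 0) (hd : d ≠ 0)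
    (h1 : 0 < a.re * b.im - a.im * b.re) (h2 : 0 < b.re * d.im - b.im * d.re)
    (hS : 0 ≤ (a.re * b.im - a.im * b.re) * (d.re ^ 2 + d.im ^ 2)
      - (a.re * d.im - a.im * d.re) * (b.re ^ 2 + b.im ^ 2)
      + (b.re * d.im - b.im * d.re) * (a.re ^ 2 + a.im ^ 2)) :
    0 < c * ‖a - b‖ / (‖a‖ * ‖b‖) ∧
    0 ≤ (c ^ 2 / ‖b‖ ^ 2 + (c * ‖a - b‖ / (‖a‖ * ‖b‖)) ^ 2 - c ^ 2 / ‖a‖ ^ 2) /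
        (c * ‖a - b‖ / (‖a‖ * ‖b‖)) +
      (c ^ 2 / ‖b‖ ^ 2 + (c * ‖b - d‖ / (‖b‖ * ‖d‖)) ^ 2 - c ^ 2 / ‖d‖ ^ 2) /
        (c * ‖b - d‖ / (‖b‖ * ‖d‖)) := by
  have na : 0 < ‖a‖ := norm_pos_iff.2 ha
  have nb : 0 < ‖b‖ := norm_pos_iff.2 hb
  have nd : 0 < ‖d‖ := norm_pos_iff.2 hd
  have nab : 0 < ‖a - b‖ := by
    rw [norm_pos_iff, sub_ne_zero]; rintro rfl
    exact absurd h1 (by rw [mul_comm]; simp)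
  have nbd : 0 < ‖b - d‖ := by
    rw [norm_pos_iff, sub_ne_zero]; rintro rfl
    exact absurd h2 (by rw [mul_comm]; simp)
  have sa := norm_sq_re_im a
  have sb := norm_sq_re_im b
  have sd := norm_sq_re_im d
  have sab := norm_sq_re_im (a - b)
  have sbd := norm_sq_re_im (b - d)
  simp only [Complex.sub_re, Complex.sub_im] at sab sbd
  refine ⟨by positivity, ?_⟩
  set P := a.re ^ 2 + a.im ^ 2 - (a.re * b.re + a.im * b.im) with hP
  set R := d.re ^ 2 + d.im ^ 2 - (d.re * b.re + d.im * b.im) with hR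
  set U := a.re * b.im - a.im * b.re with hU
  set V := b.re * d.im - b.im * d.re with hV
  have e1 : (c ^ 2 / ‖b‖ ^ 2 + (c * ‖a - b‖ / (‖a‖ * ‖b‖)) ^ 2 - c ^ 2 / ‖a‖ ^ 2) /
        (c * ‖a - b‖ / (‖a‖ * ‖b‖)) = 2 * (c * P / (‖a‖ * ‖b‖ * ‖a - b‖)) := by
    rw [div_pow, mul_pow, mul_pow]
    field_simp
    rw [sab, sa, sb]; rw [hP]; ring
  have e2 : (c ^ 2 / ‖b‖ ^ 2 + (c * ‖b - d‖ / (‖b‖ * ‖d‖)) ^ 2 - c ^ 2 / ‖d‖ ^ 2) /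
        (c * ‖b - d‖ / (‖b‖ * ‖d‖)) = 2 * (c * R / (‖b‖ * ‖d‖ * ‖b - d‖)) := by
    rw [div_pow, mul_pow, mul_pow]
    field_simp
    rw [sbd, sd, sb]; rw [hR]; ring
  rw [e1, e2, ← mul_add]
  refine mul_nonneg (by norm_num) ?_
  apply L1_conv _ _ (c * U / (‖a‖ * ‖b‖ * ‖a - b‖)) (c * V / (‖b‖ * ‖d‖ * ‖b - d‖))
    (by positivity) (by positivity)
  · have f1 : (c * P / (‖a‖ * ‖b‖ * ‖a - b‖)) ^ 2 + (c * U / (‖a‖ * ‖b‖ * ‖a - b‖)) ^ 2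
        = c ^ 2 / ‖b‖ ^ 2 := by
      have : P ^ 2 + U ^ 2 = ‖a‖ ^ 2 * ‖a - b‖ ^ 2 := by rw [sa, sab, hP, hU]; ring
      rw [div_pow, div_pow, ← add_div, mul_pow, mul_pow, ← mul_add, this]
      field_simp
    have f2 : (c * R / (‖b‖ * ‖d‖ * ‖b - d‖)) ^ 2 + (c * V / (‖b‖ * ‖d‖ * ‖b - d‖)) ^ 2
        = c ^ 2 / ‖b‖ ^ 2 := by
      have : R ^ 2 + V ^ 2 = ‖d‖ ^ 2 * ‖b - d‖ ^ 2 := by rw [sd, sbd, hR, hV]; ring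
      rw [div_pow, div_pow, ← add_div, mul_pow, mul_pow, ← mul_add, this]
      field_simp
    rw [f1, f2]
  · rw [div_div_div_cancel_right₀ (by positivity), div_div_div_cancel_right₀ (by positivity),
      mul_div_mul_left _ _ hc.ne', mul_div_mul_left _ _ hc.ne', div_add_div _ _ h1.ne' h2.ne']
    apply div_nonneg _ (by positivity)
    refine hS.trans_eq ?_
    rw [hP, hR, hU, hV]; ring

theorem fin_two {m : ℕ} [NeZero m] (k : Fin m) : k + 2 = k + 1 + 1 := by
  have : (2 : Fin m) = 1 + 1 := by
    apply Fin.ext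
    rw [Fin.val_add, Fin.val_one', ← Nat.add_mod]
    rfl
  rw [this, add_assoc]

theorem bridge {m : ℕ} [NeZero m] (p : ℂ) (q : Fin m → ℂ) (c : ℝ) (hc : 0 < c)
    (hemb : IsStarEmbedding p q) (hdel : IsDelaunayStar p q) (y l : Fin m → ℝ)
    (hy : y = fun k => c ^ 2 / ‖q k - p‖ ^ 2)
    (hl : l = fun k => c * ‖(q k - p) - (q (k + 1) - p)‖ / (‖q k - p‖ * ‖q (k + 1) - p‖)) :
    (∀ k, q k - p ≠ 0) ∧ (∀ k, 0 < l k) ∧ (∀ k, 0 < y k) ∧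
    (∀ k, 0 < 4 * y k * y (k + 1) - (y k + y (k + 1) - l k ^ 2) ^ 2) ∧
    (∀ k, 0 ≤ (y (k + 1) + l k ^ 2 - y k) / l k
        + (y (k + 1) + l (k + 1) ^ 2 - y (k + 1 + 1)) / l (k + 1)) ∧
    ∑ k, Real.arccos ((y k + y (k + 1) - l k ^ 2) / (2 * √(y k * y (k + 1)))) = 2 * π := by
  have ht := fun k => tri_aux (q k - p) (q (k + 1) - p) c hc (hemb.2.1 k)
  have hD := fun k => del_aux (q k - p) (q (k + 1) - p) (q (k + 1 + 1) - p) c hc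
    (ht k).1 (ht k).2.1 (ht (k + 1)).2.1 (ht k).2.2.1 (ht (k + 1)).2.2.1 (by
      have := circ_aux p (q k) (q (k + 1)) (q (k + 1 + 1))
        (by simpa only [Complex.sub_re, Complex.sub_im] using (ht k).2.2.1)
        (fun c r h1 h2 h3 => by
          have := (hdel k c r h1 h2 h3).1
          rwa [fin_two] at this)
      simpa only [Complex.sub_re, Complex.sub_im] using this)
  subst hy hl
  refine ⟨fun k => (ht k).1, fun k => (hD k).1, fun k => ?_, fun k => (ht k).2.2.2.1,
    fun k => (hD k).2, ?_⟩
  · have := norm_pos_iff.2 (ht k).1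
    positivity
  · rw [← hemb.2.2]
    exact Finset.sum_congr rfl fun k _ => ((ht k).2.2.2.2).symm

theorem maxp {m : ℕ} [NeZero m] (p p' : ℂ) (q q' : Fin m → ℂ)
    (u0 : ℝ) (uB : Fin m → ℝ)
    (hemb : IsStarEmbedding p q) (hemb' : IsStarEmbedding p' q')
    (hdel : IsDelaunayStar p q) (hdel' : IsDelaunayStar p' q')
    (hconf1 : ∀ k : Fin m,
      dist p' (q' k) = Real.exp ((u0 + uB k) / 2) * dist p (q k))
    (hconf2 : ∀ k : Fin m, dist (q' k) (q' (k + 1)) =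
      Real.exp ((uB k + uB (k + 1)) / 2) * dist (q k) (q (k + 1)))
    (h : (∀ k, uB k ≤ u0) ∨ (∀ k, u0 ≤ uB k)) : ∀ k : Fin m, uB k = u0 := by
  obtain ⟨n1, l1, y1, T1, D1, s1⟩ := bridge p q 1 one_pos hemb hdel _ _ rfl rfl
  have c1 : ∀ k, ‖q' k - p'‖ = Real.exp ((u0 + uB k) / 2) * ‖q k - p‖ := fun k => by
    have := hconf1 k
    rwa [dist_comm p', dist_comm p, dist_eq_norm, dist_eq_norm] at this
  have hll : (fun k => Real.exp u0 * ‖(q' k - p') - (q' (k + 1) - p')‖ /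
      (‖q' k - p'‖ * ‖q' (k + 1) - p'‖)) =
      fun k => 1 * ‖(q k - p) - (q (k + 1) - p)‖ / (‖q k - p‖ * ‖q (k + 1) - p‖) := by
    funext k
    have c2 := hconf2 k
    rw [dist_eq_norm, dist_eq_norm] at c2
    rw [sub_sub_sub_cancel_right, sub_sub_sub_cancel_right, c2, c1, c1]
    have e : Real.exp u0 * Real.exp ((uB k + uB (k + 1)) / 2) =
        Real.exp ((u0 + uB k) / 2) * Real.exp ((u0 + uB (k + 1)) / 2) := by
      rw [← Real.exp_add, ← Real.exp_add]; congr 1; ring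
    have a1 := norm_pos_iff.2 (n1 k)
    have a2 := norm_pos_iff.2 (n1 (k + 1))
    rw [← mul_assoc, e]
    field_simp
  have hyy : ∀ k, Real.exp u0 ^ 2 / ‖q' k - p'‖ ^ 2 =
      Real.exp (u0 - uB k) * (1 ^ 2 / ‖q k - p‖ ^ 2) := by
    intro k
    rw [c1]
    have e : Real.exp u0 ^ 2 = Real.exp (u0 - uB k) * Real.exp ((u0 + uB k) / 2) ^ 2 := by
      rw [← Real.exp_nat_mul, ← Real.exp_nat_mul, ← Real.exp_add]; congr 1; push_cast; ring
    have a1 := norm_pos_iff.2 (n1 k)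
    rw [e]; field_simp
  obtain ⟨n2, l2, y2, T2, D2, s2⟩ := bridge p' q' (Real.exp u0) (Real.exp_pos _) hemb' hdel'
    _ _ rfl hll.symm
  have fin : ∀ k, Real.exp u0 ^ 2 / ‖q' k - p'‖ ^ 2 = 1 ^ 2 / ‖q k - p‖ ^ 2 → uB k = u0 := by
    intro k hk
    rw [hyy k] at hk
    have a1 := y1 k
    have : Real.exp (u0 - uB k) = 1 := by
      apply mul_right_cancel₀ a1.ne'
      simpa using hk
    rw [Real.exp_eq_one_iff] at this
    linarith
  rcases h with h | h
  · intro k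
    refine fin k (core _ _ _ l1 y1 (fun k => ?_) T1 T2 D1 D2 (s1.trans s2.symm) k)
    rw [hyy k]
    exact le_mul_of_one_le_left (y1 k).le (Real.one_le_exp (by linarith [h k]))
  · intro k
    refine fin k (core _ _ _ l1 y2 (fun k => ?_) T2 T1 D2 D1 (s2.trans s1.symm) k).symm
    rw [hyy k]
    exact mul_le_of_le_one_left (y1 k).le (Real.exp_le_one_iff.2 (by linarith [h k]))

/-- Euclidean maximum principle on a 1-ring: let `φ, φ'` be two
Delaunay geodesic embeddings of the star of an interior vertex `i` (center sent
to `p`, resp. `p'`, boundary to `q`, resp. `q'`), whose induced PL metrics are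
discrete conformal with factor `u` (value `u0` at the center, `uB k` at the
boundary vertices). Then `|u|` attains its maximum on the boundary:
`|u0| ≤ max_{j ∈ ∂R_i} |u_j|`; and if `|u0| = max_{j ∈ R_i} |u_j|` then `u` is
constant on the star. -/
theorem stmt11 {m : ℕ} [NeZero m] (hm : 3 ≤ m) (p p' : ℂ) (q q' : Fin m → ℂ)
    (u0 : ℝ) (uB : Fin m → ℝ)
    (hemb : IsStarEmbedding p q) (hemb' : IsStarEmbedding p' q')
    (hdel : IsDelaunayStar p q) (hdel' : IsDelaunayStar p' q')
    (hconf1 : ∀ k : Fin m,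
      dist p' (q' k) = Real.exp ((u0 + uB k) / 2) * dist p (q k))
    (hconf2 : ∀ k : Fin m, dist (q' k) (q' (k + 1)) =
      Real.exp ((uB k + uB (k + 1)) / 2) * dist (q k) (q (k + 1))) :
    (∃ k : Fin m, |u0| ≤ |uB k|) ∧
    ((∀ k : Fin m, |uB k| ≤ |u0|) → ∀ k : Fin m, uB k = u0) := by

  have hB : (∀ k : Fin m, |uB k| ≤ |u0|) → ∀ k : Fin m, uB k = u0 := by
    intro h
    refine maxp p p' q q' u0 uB hemb hemb' hdel hdel' hconf1 hconf2 ?_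
    rcases le_total 0 u0 with h0 | h0
    · left
      intro k
      have := h k
      rw [abs_of_nonneg h0] at this
      exact (le_abs_self _).trans this
    · right
      intro k
      have := h k
      rw [abs_of_nonpos h0] at this
      linarith [neg_abs_le (uB k)]
  refine ⟨?_, hB⟩
  by_contra hc
  push Not at hc
  have h1 := hB (fun k => (hc k).le) 0
  have h2 := hc 0
  rw [h1] at h2
  exact lt_irrefl _ h2
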